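/- Let Σ_D be the (M,N) Dyck-Motzkin shift. The set { f ∈ C(Σ_D) : h(μ) = 0 for all μ ∈ M_max(f) } is a dense G_δ subset of C(Σ_D). -/

import Mathlib

open MeasureTheory Topology Filter
open scoped ENNReal NNReal


/-! ### The alphabet of the (M,N) Dyck–Motzkin shift -/

/-- The alphabet `D = D_α ∪ D_0 ∪ D_β` of the `(M,N)` Dyck–Motzkin shift:
`la k` is the left bracket `α_k`, `u k` is the unit `1_k`, `ra k` is the right bracket `β_k`. -/
inductive DMSym (M N : ℕ) : Type where
  | la : Fin M → DMSym M N
  | u  : Fin N → DMSym M N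
  | ra : Fin M → DMSym M N
deriving DecidableEq

namespace DMSym

def equivSum (M N : ℕ) : DMSym M N ≃ (Fin M ⊕ Fin N ⊕ Fin M) where
  toFun s := match s with
    | .la k => Sum.inl k
    | .u k => Sum.inr (Sum.inl k)
    | .ra k => Sum.inr (Sum.inr k)
  invFun s := match s with
    | Sum.inl k => .la k
    | Sum.inr (Sum.inl k) => .u k
    | Sum.inr (Sum.inr k) => .ra k
  left_inv s := by cases s <;> rfl
  right_inv s := by rcases s with k | k | k <;> rfl

instance (M N : ℕ) : Fintype (DMSym M N) := Fintype.ofEquiv _ (equivSum M N).symm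
instance (M N : ℕ) : TopologicalSpace (DMSym M N) := ⊥
instance (M N : ℕ) : DiscreteTopology (DMSym M N) := ⟨rfl⟩
instance (M N : ℕ) : MeasurableSpace (DMSym M N) := ⊤
instance (M N : ℕ) : BorelSpace (DMSym M N) := ⟨borel_eq_top_of_discrete.symm⟩

end DMSym

/-- Nonzero elements of the Dyck–Motzkin monoid with zero are represented in normal form:
`some (bs, as)` is the reduced word `β_{bs(0)} ⋯ β_{bs(r)} α_{as(0)} ⋯ α_{as(s)}`
(in particular `some ([], [])` is the unit element `1`); `none` is the zero element `0`. -/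
abbrev DyckElem (M : ℕ) := Option (List (Fin M) × List (Fin M))

/-- Multiplication, in the Dyck–Motzkin monoid with zero, of an element in normal form on
the right by a generator: units are absorbed, a left bracket is appended, and a right bracket
either closes the last left bracket (if the indices match), is appended (if there is no left
bracket to close), or produces the zero element (if the indices do not match). -/
def dyckStep {M N : ℕ} : DyckElem M → DMSym M N → DyckElem M
  | none, _ => none
  | some (bs, as), .la k => some (bs, as ++ [k])
  | some (bs, as), .u _ => some (bs, as)
  | some (bs, as), .ra k =>
      match as.getLast? with
      | none => some (bs ++ [k], [])
      | some j => if j = k then some (bs, as.dropLast) else none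

/-- `red w` is the image of the word `w` in the Dyck–Motzkin monoid with zero. -/
def red {M N : ℕ} (w : List (DMSym M N)) : DyckElem M :=
  w.foldl dyckStep (some ([], []))

/-- The word `x_j x_{j+1} ⋯ x_k` read off a bi-infinite sequence `x`. -/
def wordAt {M N : ℕ} (x : ℤ → DMSym M N) (j k : ℤ) : List (DMSym M N) :=
  (List.range (k + 1 - j).toNat).map fun n => x (j + n)

/-- The `(M,N)` Dyck–Motzkin shift `Σ_D`. -/
def SigmaD (M N : ℕ) : Set (ℤ → DMSym M N) :=
  {x | ∀ j k : ℤ, j < k → red (wordAt x j k) ≠ none}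

/-- The left shift `σ`. -/
def shift {A : Type*} : (ℤ → A) → (ℤ → A) := fun x i => x (i + 1)

/-- The inverse `σ⁻¹` of the left shift. -/
def shiftInv {A : Type*} : (ℤ → A) → (ℤ → A) := fun x i => x (i - 1)

lemma wordAt_shift {M N : ℕ} (x : ℤ → DMSym M N) (j k : ℤ) :
    wordAt (shift x) j k = wordAt x (j + 1) (k + 1) := by
  simp only [wordAt, shift]
  rw [show (k + 1 + 1 - (j + 1) : ℤ) = k + 1 - j by ring]
  exact List.map_congr_left fun n _ => by rw [show (j + n + 1 : ℤ) = j + 1 + n by ring]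

lemma shift_mem_SigmaD {M N : ℕ} {x : ℤ → DMSym M N} (hx : x ∈ SigmaD M N) :
    shift x ∈ SigmaD M N := by
  intro j k hjk
  rw [wordAt_shift]
  exact hx (j + 1) (k + 1) (by omega)

/-- The left shift acting on `Σ_D`. -/
def shiftD (M N : ℕ) : ↥(SigmaD M N) → ↥(SigmaD M N) :=
  fun x => ⟨shift x.val, shift_mem_SigmaD x.property⟩

section Generic
variable {X : Type*} [MeasurableSpace X]

/-- The set of `T`-invariant Borel probability measures. -/
def InvMeas (T : X → X) : Set (ProbabilityMeasure X) :=
  {μ | MeasurePreserving T μ.toMeasure μ.toMeasure}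

/-- The set of `T`-invariant ergodic Borel probability measures. -/
def ErgMeas (T : X → X) : Set (ProbabilityMeasure X) :=
  {μ | Ergodic T μ.toMeasure}

/-- A `CO`-measure: an invariant ergodic probability measure supported on the orbit of a
single periodic point. -/
def IsCOMeas (T : X → X) (μ : ProbabilityMeasure X) : Prop :=
  Ergodic T μ.toMeasure ∧
    ∃ (x : X) (n : ℕ), 0 < n ∧ T^[n] x = x ∧
      μ.toMeasure {y | ∃ k : ℕ, y = T^[k] x} = 1

/-- Convexity for a set of probability measures: it is stable under taking the convex
combination `t•μ + (1-t)•ν` of any two of its members. -/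
def ConvexMeasSet (U : Set (ProbabilityMeasure X)) : Prop :=
  ∀ μ ∈ U, ∀ ν ∈ U, ∀ t : ℝ≥0∞, t ≤ 1 → ∀ ρ : ProbabilityMeasure X,
    ρ.toMeasure = t • μ.toMeasure + (1 - t) • ν.toMeasure → ρ ∈ U

/-- A measure is fully supported if it gives positive measure to every non-empty open set. -/
def FullSupp [TopologicalSpace X] (μ : ProbabilityMeasure X) : Prop :=
  ∀ U : Set X, IsOpen U → U.Nonempty → 0 < μ.toMeasure U

/-- Measure-theoretic isomorphism of the measure-preserving systems `(X,T,μ)` and `(Y,S,ν)`. -/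
def MeasureIso {Y : Type*} [MeasurableSpace Y] (T : X → X) (S : Y → Y)
    (μ : Measure X) (ν : Measure Y) : Prop :=
  ∃ (φ : X → Y) (ψ : Y → X), Measurable φ ∧ Measurable ψ ∧
    Measure.map φ μ = ν ∧ Measure.map ψ ν = μ ∧
    (∀ᵐ x ∂μ, ψ (φ x) = x) ∧ (∀ᵐ y ∂ν, φ (ψ y) = y) ∧
    (∀ᵐ x ∂μ, φ (T x) = S (φ x))

/-- The system `(X,T,μ)` is Bernoulli: it is measure-theoretically isomorphic to a two-sided
Bernoulli shift, i.e. the left shift on `ℤ → ℕ` equipped with an i.i.d. product measure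
(determined by requiring that the measures of all cylinder sets factorize according to a
fixed distribution `p`). -/
def IsBernoulli (T : X → X) (μ : Measure X) : Prop :=
  ∃ (p : ℕ → ℝ≥0∞) (ν : Measure (ℤ → ℕ)), (∑' n, p n) = 1 ∧
    IsProbabilityMeasure ν ∧
    (∀ (n : ℕ) (w : Fin n → ℕ) (j : ℤ),
      ν {y | ∀ i : Fin n, y (j + (i : ℕ)) = w i} = ∏ i, p (w i)) ∧
    MeasureIso T shift μ ν

end Generic

/-- `M(Σ_D)`: the space of shift-invariant Borel probability measures on `Σ_D`,
endowed with the weak* topology. -/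
def MinvD (M N : ℕ) : Set (ProbabilityMeasure ↥(SigmaD M N)) := InvMeas (shiftD M N)

/-- `M^e(Σ_D)`: the shift-invariant ergodic Borel probability measures on `Σ_D`. -/
def MergD (M N : ℕ) : Set (ProbabilityMeasure ↥(SigmaD M N)) := ErgMeas (shiftD M N)

/-- The integral `∫ f dμ`. -/
noncomputable def intCf {M N : ℕ} (f : C(↥(SigmaD M N), ℝ))
    (μ : ProbabilityMeasure ↥(SigmaD M N)) : ℝ := ∫ x, f x ∂μ.toMeasure

/-- `M_max(f)`: the set of `f`-maximizing measures, i.e. the shift-invariant measures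
attaining `sup { ∫ f dν : ν ∈ M(Σ_D) }`. -/
def Mmax (M N : ℕ) (f : C(↥(SigmaD M N), ℝ)) : Set (ProbabilityMeasure ↥(SigmaD M N)) :=
  {μ ∈ MinvD M N | ∀ ν ∈ MinvD M N, intCf f ν ≤ intCf f μ}

/-- The measure-theoretic (Kolmogorov–Sinai) entropy of a shift-invariant measure on a
subshift: by the Kolmogorov–Sinai theorem applied to the natural generating partition and
Fekete's subadditivity lemma, it equals the infimum over `n` of the `n`-th Shannon
cylinder-entropy divided by `n`. -/
noncomputable def entropy {M N : ℕ} (μ : ProbabilityMeasure ↥(SigmaD M N)) : ℝ :=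
  ⨅ n : ℕ,
    (∑ w : Fin (n + 1) → DMSym M N,
      Real.negMulLog
        ((μ.toMeasure {x : ↥(SigmaD M N) |
          ∀ i : Fin (n + 1), x.val ((i : ℕ) : ℤ) = w i}).toReal)) / (n + 1)


/-! ### Combinatorics of reduction -/
section Comb
variable {M N : ℕ}

lemma foldl_none (w : List (DMSym M N)) : w.foldl dyckStep (none : DyckElem M) = none := by
  induction w with
  | nil => rfl
  | cons s w ih => simpa [dyckStep] using ih

lemma eq_nil_or_app {A : Type*} (l : List A) : l = [] ∨ ∃ l' a, l = l' ++ [a] := by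
  rcases List.eq_nil_or_concat l with h | ⟨l', a, h⟩
  · exact Or.inl h
  · exact Or.inr ⟨l', a, by simpa using h⟩

lemma step_ra_nil (b : List (Fin M)) (k : Fin M) :
    dyckStep (some (b, [])) (DMSym.ra k : DMSym M N) = some (b ++ [k], []) := by
  simp [dyckStep]

lemma step_ra_concat (b a : List (Fin M)) (j k : Fin M) :
    dyckStep (some (b, a ++ [j])) (DMSym.ra k : DMSym M N)
      = if j = k then some (b, a) else none := by
  simp [dyckStep]

/-- Prefixing right brackets does not affect the reduction. -/
lemma fold_prefix_b (p : List (Fin M)) (w : List (DMSym M N)) : ∀ (b a b' a' : List (Fin M)),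
    w.foldl dyckStep (some (b, a)) = some (b', a') →
    w.foldl dyckStep (some (p ++ b, a)) = some (p ++ b', a') := by
  induction w with
  | nil => intro b a b' a' h; simp at h ⊢; exact h
  | cons s w ih =>
    intro b a b' a' h
    rw [List.foldl_cons] at h ⊢
    cases s with
    | la k => exact ih _ _ _ _ h
    | u k => exact ih _ _ _ _ h
    | ra k =>
      rcases eq_nil_or_app a with rfl | ⟨a, j, rfl⟩
      · rw [step_ra_nil] at h ⊢
        rw [List.append_assoc]
        exact ih _ _ _ _ h
      · simp only [step_ra_concat] at h ⊢
        split_ifs at h ⊢ with hjk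
        · exact ih _ _ _ _ h
        · rw [foldl_none] at h; cases h

lemma fold_len_b (w : List (DMSym M N)) : ∀ (b a b' a' : List (Fin M)),
    w.foldl dyckStep (some (b, a)) = some (b', a') → b.length ≤ b'.length := by
  induction w with
  | nil => intro b a b' a' h; simp at h; rw [h.1]
  | cons s w ih =>
    intro b a b' a' h
    rw [List.foldl_cons] at h
    cases s with
    | la k => exact ih _ _ _ _ h
    | u k => exact ih _ _ _ _ h
    | ra k =>
      rcases eq_nil_or_app a with rfl | ⟨a, j, rfl⟩
      · rw [step_ra_nil] at h
        have := ih _ _ _ _ h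
        simp at this; omega
      · simp only [step_ra_concat] at h
        split_ifs at h with hjk
        · exact ih _ _ _ _ h
        · rw [foldl_none] at h; cases h

/-- Prefixing left brackets does not affect the reduction if no right bracket is unmatched. -/
lemma fold_prefix_a (q : List (Fin M)) (w : List (DMSym M N)) : ∀ (b a a' : List (Fin M)),
    w.foldl dyckStep (some (b, a)) = some (b, a') →
    w.foldl dyckStep (some (b, q ++ a)) = some (b, q ++ a') := by
  induction w with
  | nil => intro b a a' h; simp at h ⊢; exact h
  | cons s w ih =>
    intro b a a' h
    rw [List.foldl_cons] at h ⊢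
    cases s with
    | la k =>
      have := ih _ _ _ h
      rw [← List.append_assoc] at this
      exact this
    | u k => exact ih _ _ _ h
    | ra k =>
      rcases eq_nil_or_app a with rfl | ⟨a, j, rfl⟩
      · rw [step_ra_nil] at h
        have := fold_len_b _ _ _ _ _ h
        simp at this
      · rw [← List.append_assoc]
        simp only [step_ra_concat] at h ⊢
        split_ifs at h ⊢ with hjk
        · exact ih _ _ _ h
        · rw [foldl_none] at h; cases h

lemma fold_sub (v : List (DMSym M N)) : ∀ (b b' q a : List (Fin M)),
    v.foldl dyckStep (some (b, q ++ a)) ≠ none → v.foldl dyckStep (some (b', a)) ≠ none := by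
  induction v with
  | nil => intro b b' q a _; simp
  | cons s w ih =>
    intro b b' q a h
    rw [List.foldl_cons] at h ⊢
    cases s with
    | la k =>
      refine ih b _ q _ ?_
      rw [← List.append_assoc]
      exact h
    | u k => exact ih _ _ _ _ h
    | ra k =>
      rcases eq_nil_or_app a with rfl | ⟨a, j, rfl⟩
      · rw [step_ra_nil]
        rcases eq_nil_or_app q with rfl | ⟨q, j, rfl⟩
        · exact ih (b ++ [k]) _ [] _ (by simpa [step_ra_nil] using h)
        · rw [List.append_nil, step_ra_concat] at h
          split_ifs at h with hjk
          · exact ih b _ q _ (by simpa using h)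
          · rw [foldl_none] at h; exact absurd rfl h
      · rw [← List.append_assoc] at h
        simp only [step_ra_concat] at h ⊢
        split_ifs at h ⊢ with hjk
        · exact ih _ _ _ _ h
        · rw [foldl_none] at h; exact absurd rfl h

lemma red_infix (u v w : List (DMSym M N)) (h : red (u ++ v ++ w) ≠ none) : red v ≠ none := by
  unfold red at *
  rw [List.foldl_append, List.foldl_append] at h
  have h1 : v.foldl dyckStep (u.foldl dyckStep (some ([], []))) ≠ none := by
    intro h'; rw [h', foldl_none] at h; exact h rfl
  rcases h2 : u.foldl dyckStep (some (([] : List (Fin M)), ([] : List (Fin M)))) with _ | ⟨b, a⟩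
  · rw [h2, foldl_none] at h1; exact absurd rfl h1
  · rw [h2] at h1
    exact fold_sub v b [] a [] (by simpa using h1)

lemma red_split (w : List (DMSym M N)) : ∀ b a, red w = some (b, a) →
    ∃ u v, w = u ++ v ∧ red u = some (b, []) ∧ red v = some ([], a) := by
  induction w using List.reverseRecOn with
  | nil => intro b a h; simp [red] at h; exact ⟨[], [], by simp [red, h]⟩
  | append_singleton w s ih =>
    intro b a h
    have hs : dyckStep (red w) s = some (b, a) := by simpa [red] using h
    rcases hw : red w with _ | ⟨b0, a0⟩
    · rw [hw] at hs; simp [dyckStep] at hs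
    rw [hw] at hs
    obtain ⟨u, v, rfl, hu, hv⟩ := ih _ _ hw
    have hvs : red (v ++ [s]) = dyckStep (some ([], a0)) s := by rw [← hv]; simp [red]
    cases s with
    | la k =>
      simp [dyckStep] at hs
      refine ⟨u, v ++ [DMSym.la k], by simp, by rw [hu, hs.1], ?_⟩
      rw [hvs]; simp [dyckStep, hs.2]
    | u k =>
      simp [dyckStep] at hs
      refine ⟨u, v ++ [DMSym.u k], by simp, by rw [hu, hs.1], ?_⟩
      rw [hvs]; simp [dyckStep, hs.2]
    | ra k =>
      rcases eq_nil_or_app a0 with rfl | ⟨a0, j, rfl⟩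
      · rw [step_ra_nil] at hs
        refine ⟨u ++ v ++ [DMSym.ra k], [], by simp, ?_, ?_⟩
        · rw [h]; simp at hs; simp [hs.2]
        · simp at hs; simp [red, hs.2]
      · rw [step_ra_concat] at hs
        rw [step_ra_concat] at hvs
        split_ifs at hs hvs with hjk
        simp at hs
        exact ⟨u, v ++ [DMSym.ra k], by simp, by rw [hu, hs.1], by rw [hvs, hs.2]⟩

/-- Words which can be repeated indefinitely. -/
def OneSided (w : List (DMSym M N)) : Prop := ∃ c, red w = some (c, []) ∨ red w = some ([], c)

/-- The word of length `n` at position `j`. -/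
def W (x : ℤ → DMSym M N) (j : ℤ) (n : ℕ) : List (DMSym M N) :=
  (List.range n).map fun i : ℕ => x (j + (i : ℤ))

lemma W_add (x : ℤ → DMSym M N) (j : ℤ) (m n : ℕ) :
    W x j (m + n) = W x j m ++ W x (j + m) n := by
  simp only [W, List.range_add, List.map_append, List.map_map]
  congr 1
  apply List.map_congr_left
  intro a _
  simp [add_assoc]

lemma wordAt_eq_W (x : ℤ → DMSym M N) (j k : ℤ) :
    wordAt x j k = W x j (k + 1 - j).toNat := by
  have : ∀ l : List ℕ, (do let a ← l; pure ((a : ℕ) : ℤ) : List ℤ) = l.map (fun a : ℕ => (a : ℤ)) := by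
    intro l
    induction l with
    | nil => rfl
    | cons a l ih => simpa using ih
  simp only [wordAt, W, this, List.map_map]
  rfl

lemma W_length (x : ℤ → DMSym M N) (j : ℤ) (n : ℕ) : (W x j n).length = n := by simp [W]

lemma mem_SigmaD_iff (x : ℤ → DMSym M N) : x ∈ SigmaD M N ↔ ∀ j n, red (W x j n) ≠ none := by
  constructor
  · intro h j n
    have := h j (j + n + 1) (by omega)
    have e : wordAt x j (j + n + 1) = W x j (n + 2) := by
      rw [wordAt_eq_W]
      congr 1
      omega
    rw [e, W_add] at this
    exact red_infix [] _ _ this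
  · intro h j k _
    rw [wordAt_eq_W]
    exact h j _

/-- The periodic sequence repeating `x_0 ... x_{p-1}`. -/
def perPt (x : ℤ → DMSym M N) (p : ℕ) : ℤ → DMSym M N := fun i => x (i % (p : ℤ))

lemma W_perPt_period (x : ℤ → DMSym M N) (p : ℕ) (m : ℤ) :
    W (perPt x p) (m * p) p = W x 0 p := by
  unfold W perPt
  apply List.map_congr_left
  intro a ha
  rw [List.mem_range] at ha
  congr 1
  rw [Int.mul_add_emod_self_right, zero_add, Int.emod_eq_of_lt] <;> omega

lemma perPt_mem (x : ℤ → DMSym M N) (p : ℕ) (hp : 0 < p) (h : OneSided (W x 0 p)) :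
    perPt x p ∈ SigmaD M N := by
  have key : ∀ (m : ℤ) (L : ℕ), red (W (perPt x p) (m * p) (L * p)) ≠ none := by
    intro m L
    obtain ⟨c, hc | hc⟩ := h
    · have : ∃ d, red (W (perPt x p) (m * p) (L * p)) = some (d, []) := by
        induction L with
        | zero => exact ⟨[], by simp [W, red]⟩
        | succ L ih =>
          obtain ⟨d, hd⟩ := ih
          refine ⟨d ++ c, ?_⟩
          rw [Nat.succ_mul, W_add]
          have e : m * (p : ℤ) + ((L * p : ℕ) : ℤ) = (m + L) * p := by push_cast; ring
          rw [e, W_perPt_period]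
          unfold red at *
          rw [List.foldl_append, hd]
          simpa using fold_prefix_b d _ _ _ _ _ hc
      obtain ⟨d, hd⟩ := this
      rw [hd]; simp
    · have : ∃ d, red (W (perPt x p) (m * p) (L * p)) = some ([], d) := by
        induction L with
        | zero => exact ⟨[], by simp [W, red]⟩
        | succ L ih =>
          obtain ⟨d, hd⟩ := ih
          refine ⟨d ++ c, ?_⟩
          rw [Nat.succ_mul, W_add]
          have e : m * (p : ℤ) + ((L * p : ℕ) : ℤ) = (m + L) * p := by push_cast; ring
          rw [e, W_perPt_period]
          unfold red at *
          rw [List.foldl_append, hd]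
          simpa using fold_prefix_a d _ _ _ _ hc
      obtain ⟨d, hd⟩ := this
      rw [hd]; simp
  rw [mem_SigmaD_iff]
  intro j n
  have hj : ∃ (m : ℤ) (a : ℕ), j = m * p + a := by
    refine ⟨j / p, (j % p).toNat, ?_⟩
    rw [Int.toNat_of_nonneg (Int.emod_nonneg _ (by omega)), mul_comm, Int.mul_ediv_add_emod]
  obtain ⟨m, a, rfl⟩ := hj
  have h1 := key m (a + n)
  have h2 : ∃ r, (a + n) * p = a + n + r :=
    ⟨(a + n) * p - (a + n), (Nat.add_sub_cancel' (Nat.le_mul_of_pos_right _ hp)).symm⟩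
  obtain ⟨r, hr⟩ := h2
  rw [hr, W_add, W_add] at h1
  exact red_infix _ _ _ h1

lemma exists_split (x : ℤ → DMSym M N) (hx : x ∈ SigmaD M N) (n : ℕ) :
    ∃ p q : ℕ, n = p + q ∧ OneSided (W x 0 p) ∧ OneSided (W x p q) := by
  rw [mem_SigmaD_iff] at hx
  rcases h : red (W x 0 n) with _ | ⟨b, a⟩
  · exact absurd h (hx 0 n)
  obtain ⟨u, v, huv, hu, hv⟩ := red_split _ _ _ h
  have hn : n = u.length + v.length := by
    rw [← List.length_append, ← huv, W_length]
  have huv2 := huv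
  rw [hn, W_add] at huv2
  obtain ⟨e1, e2⟩ := List.append_inj huv2 (by simp [W_length])
  refine ⟨u.length, v.length, hn, ⟨b, Or.inl ?_⟩, ⟨a, Or.inr ?_⟩⟩
  · rw [e1, hu]
  · rw [zero_add] at e2
    rw [e2, hv]

end Comb

/-! ### Topology -/
section Top
variable {M N : ℕ}

/-- The word of coordinates `0, ..., n`. -/
def wrd (n : ℕ) (x : ↥(SigmaD M N)) : Fin (n + 1) → DMSym M N :=
  fun i => x.val ((i : ℕ) : ℤ)

lemma continuous_coord (i : ℤ) : Continuous fun x : ↥(SigmaD M N) => x.val i :=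
  (continuous_apply i).comp continuous_subtype_val

lemma continuous_wrd (n : ℕ) : Continuous (wrd n : ↥(SigmaD M N) → _) :=
  continuous_pi fun _ => continuous_coord _

lemma isClosed_SigmaD : IsClosed (SigmaD M N) := by
  have : SigmaD M N = ⋂ (j : ℤ) (n : ℕ), {x | red (W x j n) ≠ none} := by
    ext x; simp [mem_SigmaD_iff]
  rw [this]
  refine isClosed_iInter fun j => isClosed_iInter fun n => ?_
  have hc : Continuous fun (x : ℤ → DMSym M N) (i : Fin n) => x (j + ((i : ℕ) : ℤ)) :=
    continuous_pi fun i => continuous_apply _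
  have e : {x : ℤ → DMSym M N | red (W x j n) ≠ none} =
      (fun (x : ℤ → DMSym M N) (i : Fin n) => x (j + ((i : ℕ) : ℤ))) ⁻¹'
        {w | red (List.ofFn w) ≠ none} := by
    ext x
    simp only [Set.mem_ofPred_eq, Set.mem_preimage]
    have : List.ofFn (fun i : Fin n => x (j + ((i : ℕ) : ℤ))) = W x j n := by
      apply List.ext_getElem <;> simp [W]
    rw [this]
  rw [e]
  exact (isClosed_discrete _).preimage hc

instance instCompactSigmaD : CompactSpace ↥(SigmaD M N) :=
  isCompact_iff_compactSpace.mp isClosed_SigmaD.isCompact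

lemma continuous_shiftD : Continuous (shiftD M N) :=
  Continuous.subtype_mk (continuous_pi fun i => continuous_coord (i + 1)) _

lemma iter_val (i : ℕ) (x : ↥(SigmaD M N)) (k : ℤ) :
    ((shiftD M N)^[i] x).val k = x.val (k + i) := by
  induction i generalizing k with
  | zero => simp
  | succ i ih =>
    rw [Function.iterate_succ_apply']
    change ((shiftD M N)^[i] x).val (k + 1) = _
    rw [ih]; push_cast; ring_nf

lemma unif_cont (f : C(↥(SigmaD M N), ℝ)) (ε : ℝ) (hε : 0 < ε) :
    ∃ K : ℕ, ∀ x y : ↥(SigmaD M N), (∀ i : ℤ, |i| ≤ K → x.val i = y.val i) → f x ≤ f y + ε := by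
  let V : ℕ → Set (↥(SigmaD M N) × ↥(SigmaD M N)) := fun K =>
    {z | ∀ i : ℤ, |i| ≤ K → z.1.val i = z.2.val i}
  have hdir : Directed (· ⊇ ·) V := by
    apply directed_of_isDirected_le
    intro a b hab z hz i hi
    exact hz i (hi.trans (by exact_mod_cast hab))
  have hcl : ∀ K, IsClosed (V K) := by
    intro K
    have : V K = ⋂ (i : ℤ) (_ : |i| ≤ K), {z | z.1.val i = z.2.val i} := by
      ext z; simp [V]
    rw [this]
    refine isClosed_iInter fun i => isClosed_iInter fun _ => ?_
    exact isClosed_eq ((continuous_coord i).comp continuous_fst)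
      ((continuous_coord i).comp continuous_snd)
  have hU : ∀ z ∈ ⋂ K, V K, {z : ↥(SigmaD M N) × ↥(SigmaD M N) | f z.1 < f z.2 + ε} ∈ 𝓝 z := by
    intro z hz
    have hopen : IsOpen {z : ↥(SigmaD M N) × ↥(SigmaD M N) | f z.1 < f z.2 + ε} :=
      isOpen_lt (by fun_prop) (by fun_prop)
    refine hopen.mem_nhds ?_
    have : z.1 = z.2 := by
      apply Subtype.ext
      funext i
      rw [Set.mem_iInter] at hz
      exact hz i.natAbs i (by simp)
    simp [this, hε]
  obtain ⟨K, hK⟩ := exists_subset_nhds_of_compactSpace hdir hcl hU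
  refine ⟨K, fun x y h => ?_⟩
  have : (x, y) ∈ V K := h
  exact (hK this).le

/-- Birkhoff sums. -/
noncomputable def BS (f : C(↥(SigmaD M N), ℝ)) (n : ℕ) (x : ↥(SigmaD M N)) : ℝ :=
  ∑ i ∈ Finset.range n, f ((shiftD M N)^[i] x)

lemma BS_add (f : C(↥(SigmaD M N), ℝ)) (p q : ℕ) (x : ↥(SigmaD M N)) :
    BS f (p + q) x = BS f p x + BS f q ((shiftD M N)^[p] x) := by
  unfold BS
  rw [Finset.sum_range_add]
  congr 1
  apply Finset.sum_congr rfl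
  intro i _
  rw [← Function.iterate_add_apply, add_comm]

lemma f_le_norm (f : C(↥(SigmaD M N), ℝ)) (x : ↥(SigmaD M N)) : |f x| ≤ ‖f‖ :=
  f.norm_coe_le_norm x

lemma BS_one_sided (f : C(↥(SigmaD M N), ℝ)) (P : ℝ)
    (hP : ∀ (y : ↥(SigmaD M N)) (p : ℕ), 0 < p → (shiftD M N)^[p] y = y → BS f p y ≤ p * P)
    (ε : ℝ) (hε : 0 < ε) (K : ℕ)
    (hK : ∀ x y : ↥(SigmaD M N), (∀ i : ℤ, |i| ≤ K → x.val i = y.val i) → f x ≤ f y + ε)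
    (z : ↥(SigmaD M N)) (p : ℕ) (hz : OneSided (W z.val 0 p)) :
    BS f p z ≤ p * (P + ε) + 4 * K * ‖f‖ := by
  rcases Nat.eq_zero_or_pos p with rfl | hp
  · simp [BS]; positivity
  let y : ↥(SigmaD M N) := ⟨perPt z.val p, perPt_mem _ p hp hz⟩
  have hy : (shiftD M N)^[p] y = y := by
    apply Subtype.ext
    funext k
    rw [iter_val]
    simp [y, perPt]
  have h1 : ∀ i ∈ Finset.range p, f ((shiftD M N)^[i] z) ≤ f ((shiftD M N)^[i] y) +
      (ε + if i ∈ Finset.range K ∪ Finset.Ico (p - K) p then 2 * ‖f‖ else 0) := by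
    intro i hi
    rw [Finset.mem_range] at hi
    split_ifs with hmem
    · have a := abs_le.1 (f_le_norm f ((shiftD M N)^[i] z))
      have b := abs_le.1 (f_le_norm f ((shiftD M N)^[i] y))
      linarith
    · rw [add_zero]
      apply hK
      intro k hk
      rw [iter_val, iter_val]
      simp only [Finset.mem_union, Finset.mem_range, Finset.mem_Ico, not_or, not_and] at hmem
      have hk' := abs_le.1 hk
      have e : (k + i) % (p : ℤ) = k + i := Int.emod_eq_of_lt (by omega) (by omega)
      simp only [y, perPt, e]
  have h2 := Finset.sum_le_sum h1
  rw [Finset.sum_add_distrib, Finset.sum_add_distrib, Finset.sum_const, Finset.card_range,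
    ← Finset.sum_filter, Finset.sum_const] at h2
  have h3 : (Finset.filter (fun i => i ∈ Finset.range K ∪ Finset.Ico (p - K) p)
      (Finset.range p)).card ≤ 2 * K := by
    calc _ ≤ (Finset.range K ∪ Finset.Ico (p - K) p).card :=
          Finset.card_le_card (fun i hi => (Finset.mem_filter.1 hi).2)
      _ ≤ K + (p - (p - K)) := by
          refine (Finset.card_union_le _ _).trans ?_
          simp
      _ ≤ 2 * K := by omega
  have h4 : ((Finset.filter (fun i => i ∈ Finset.range K ∪ Finset.Ico (p - K) p)
      (Finset.range p)).card : ℝ) ≤ 2 * K := by exact_mod_cast h3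
  have h5 := hP y p hp hy
  have h6 := mul_le_mul_of_nonneg_right h4 (show 0 ≤ 2 * ‖f‖ by positivity)
  simp only [nsmul_eq_mul] at h2
  unfold BS at *
  nlinarith

lemma BS_le (f : C(↥(SigmaD M N), ℝ)) (P : ℝ)
    (hP : ∀ (y : ↥(SigmaD M N)) (p : ℕ), 0 < p → (shiftD M N)^[p] y = y → BS f p y ≤ p * P)
    (ε : ℝ) (hε : 0 < ε) : ∃ C : ℝ, ∀ (n : ℕ) (x : ↥(SigmaD M N)), BS f n x ≤ n * (P + ε) + C := by
  obtain ⟨K, hK⟩ := unif_cont f ε hε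
  refine ⟨8 * K * ‖f‖, fun n x => ?_⟩
  obtain ⟨p, q, rfl, h1, h2⟩ := exists_split x.val x.property n
  rw [BS_add]
  have a := BS_one_sided f P hP ε hε K hK x p h1
  have b := BS_one_sided f P hP ε hε K hK ((shiftD M N)^[p] x) q (by
    have : W ((shiftD M N)^[p] x).val 0 q = W x.val p q := by
      unfold W
      apply List.map_congr_left
      intro i _
      rw [iter_val]
      ring_nf
    rw [this]; exact h2)
  push_cast
  linarith

lemma integrable_cf (f : C(↥(SigmaD M N), ℝ)) (μ : ProbabilityMeasure ↥(SigmaD M N)) :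
    Integrable f μ.toMeasure :=
  f.continuous.integrable_of_hasCompactSupport (HasCompactSupport.of_compactSpace _)

lemma int_BS (f : C(↥(SigmaD M N), ℝ)) (μ : ProbabilityMeasure ↥(SigmaD M N))
    (hμ : μ ∈ MinvD M N) (n : ℕ) : ∫ x, BS f n x ∂μ.toMeasure = n * intCf f μ := by
  have hμ' : MeasurePreserving (shiftD M N) μ.toMeasure μ.toMeasure := hμ
  have h : ∀ i, ∫ x, f ((shiftD M N)^[i] x) ∂μ.toMeasure = intCf f μ := by
    intro i
    have hi := hμ'.iterate i
    have := integral_map (μ := μ.toMeasure) hi.measurable.aemeasurable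
      (f := f) f.continuous.aestronglyMeasurable
    rw [hi.map_eq] at this
    exact this.symm
  unfold BS
  rw [integral_finsetSum]
  · simp [h]
  · intro i _
    exact integrable_cf (f.comp ⟨_, continuous_shiftD.iterate i⟩) μ

lemma int_le (f : C(↥(SigmaD M N), ℝ)) (P : ℝ)
    (hP : ∀ (y : ↥(SigmaD M N)) (p : ℕ), 0 < p → (shiftD M N)^[p] y = y → BS f p y ≤ p * P)
    (μ : ProbabilityMeasure ↥(SigmaD M N)) (hμ : μ ∈ MinvD M N) : intCf f μ ≤ P := by
  apply le_of_forall_pos_le_add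
  intro ε hε
  obtain ⟨C, hC⟩ := BS_le f P hP ε hε
  by_contra! hlt
  obtain ⟨n, hn⟩ := exists_nat_gt (C / (intCf f μ - (P + ε)))
  rw [div_lt_iff₀ (by linarith)] at hn
  have h1 : ∫ x, BS f n x ∂μ.toMeasure ≤ ∫ _x, (n * (P + ε) + C) ∂μ.toMeasure := by
    apply integral_mono
    · exact integrable_finsetSum _ fun i _ =>
        integrable_cf (f.comp ⟨_, continuous_shiftD.iterate i⟩) μ
    · exact integrable_const _
    · intro x; exact hC n x
  rw [int_BS f μ hμ] at h1
  simp at h1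
  linarith

/-- The invariant measure on a periodic orbit. -/
lemma exists_per_meas (y : ↥(SigmaD M N)) (p : ℕ) (hp : 0 < p) (hy : (shiftD M N)^[p] y = y) :
    ∃ ν ∈ MinvD M N, ∀ f : C(↥(SigmaD M N), ℝ), intCf f ν = BS f p y / p := by
  let m : Measure ↥(SigmaD M N) :=
    (p : ℝ≥0∞)⁻¹ • ∑ i ∈ Finset.range p, Measure.dirac ((shiftD M N)^[i] y)
  have hp0 : (p : ℝ≥0∞) ≠ 0 := by exact_mod_cast hp.ne'
  have hm : IsProbabilityMeasure m := by
    constructor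
    simp [m, ENNReal.inv_mul_cancel hp0 (ENNReal.natCast_ne_top p)]
  refine ⟨⟨m, hm⟩, ?_, ?_⟩
  · change MeasurePreserving (shiftD M N) m m
    refine ⟨continuous_shiftD.measurable, ?_⟩
    ext s hs
    rw [Measure.map_apply continuous_shiftD.measurable hs]
    simp only [m, Measure.smul_apply, Measure.finsetSum_apply]
    congr 1
    have h1 : ∀ i, Measure.dirac ((shiftD M N)^[i] y) (shiftD M N ⁻¹' s)
        = Measure.dirac ((shiftD M N)^[i + 1] y) s := by
      intro i
      rw [Measure.dirac_apply' _ hs, Measure.dirac_apply' _ (continuous_shiftD.measurable hs),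
        Function.iterate_succ_apply']
      rfl
    simp only [h1]
    obtain ⟨q, rfl⟩ : ∃ q, p = q + 1 := ⟨p - 1, by omega⟩
    rw [Finset.sum_range_succ, hy, Finset.sum_range_succ']
    simp
  · intro f
    change ∫ x, f x ∂m = _
    simp only [m]
    rw [integral_smul_measure, integral_finsetSum_measure]
    · simp [BS, integral_dirac]
      field_simp
    · intro i _
      exact integrable_dirac (by simp)

end Top

/-! ### Entropy -/
section Ent
variable {M N : ℕ}

/-- The measure of a cylinder. -/
noncomputable def cyl (μ : ProbabilityMeasure ↥(SigmaD M N)) (n : ℕ)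
    (w : Fin (n + 1) → DMSym M N) : ℝ :=
  (μ.toMeasure {x : ↥(SigmaD M N) | ∀ i : Fin (n + 1), x.val ((i : ℕ) : ℤ) = w i}).toReal

/-- The normalized Shannon entropy of cylinders. -/
noncomputable def Hn (μ : ProbabilityMeasure ↥(SigmaD M N)) (n : ℕ) : ℝ :=
  (∑ w : Fin (n + 1) → DMSym M N, Real.negMulLog (cyl μ n w)) / (n + 1)

lemma entropy_eq (μ : ProbabilityMeasure ↥(SigmaD M N)) : entropy μ = ⨅ n, Hn μ n := rfl

/-- Indicator of a set of words, as a continuous function. -/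
noncomputable def wInd (n : ℕ) (S : Finset (Fin (n + 1) → DMSym M N)) : C(↥(SigmaD M N), ℝ) :=
  ⟨fun x => if wrd n x ∈ S then 1 else 0,
    (continuous_of_discreteTopology (f := fun w : Fin (n + 1) → DMSym M N =>
      if w ∈ S then (1 : ℝ) else 0)).comp (continuous_wrd n)⟩

lemma cyl_eq_int (μ : ProbabilityMeasure ↥(SigmaD M N)) (n : ℕ)
    (w : Fin (n + 1) → DMSym M N) : cyl μ n w = intCf (wInd n {w}) μ := by
  have hm : MeasurableSet (wrd n ⁻¹' {w} : Set ↥(SigmaD M N)) :=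
    ((isClosed_discrete _).preimage (continuous_wrd n)).measurableSet
  have h1 : cyl μ n w = (μ.toMeasure).real (wrd n ⁻¹' {w}) := by
    unfold cyl Measure.real
    congr 2
    ext x
    exact ⟨fun h => funext h, fun h i => congrFun h i⟩
  rw [h1, ← integral_indicator_one hm]
  unfold intCf
  congr 1
  funext x
  by_cases h : wrd n x = w <;> simp [wInd, Set.indicator, h]

lemma sum_cyl (μ : ProbabilityMeasure ↥(SigmaD M N)) (n : ℕ)
    (S : Finset (Fin (n + 1) → DMSym M N)) : ∑ w ∈ S, cyl μ n w = intCf (wInd n S) μ := by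
  simp only [cyl_eq_int, intCf]
  rw [← integral_finsetSum _ fun w _ => integrable_cf _ μ]
  congr 1
  funext x
  simp [wInd]

lemma cyl_nonneg (μ : ProbabilityMeasure ↥(SigmaD M N)) (n : ℕ)
    (w : Fin (n + 1) → DMSym M N) : 0 ≤ cyl μ n w := ENNReal.toReal_nonneg

lemma sum_cyl_le_one (μ : ProbabilityMeasure ↥(SigmaD M N)) (n : ℕ)
    (S : Finset (Fin (n + 1) → DMSym M N)) : ∑ w ∈ S, cyl μ n w ≤ 1 := by
  rw [sum_cyl]
  calc intCf (wInd n S) μ ≤ ∫ _x, (1 : ℝ) ∂μ.toMeasure := by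
        apply integral_mono (integrable_cf _ μ) (integrable_const _)
        intro x
        simp only [wInd, ContinuousMap.coe_mk]
        split_ifs <;> norm_num
    _ = 1 := by simp

lemma cyl_le_one (μ : ProbabilityMeasure ↥(SigmaD M N)) (n : ℕ)
    (w : Fin (n + 1) → DMSym M N) : cyl μ n w ≤ 1 := by
  simpa using sum_cyl_le_one μ n {w}

lemma Hn_nonneg (μ : ProbabilityMeasure ↥(SigmaD M N)) (n : ℕ) : 0 ≤ Hn μ n :=
  div_nonneg (Finset.sum_nonneg fun w _ =>
    Real.negMulLog_nonneg (cyl_nonneg μ n w) (cyl_le_one μ n w)) (by positivity)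

lemma Hn_bdd (μ : ProbabilityMeasure ↥(SigmaD M N)) : BddBelow (Set.range (Hn μ)) :=
  ⟨0, by rintro _ ⟨n, rfl⟩; exact Hn_nonneg μ n⟩

lemma entropy_nonneg (μ : ProbabilityMeasure ↥(SigmaD M N)) : 0 ≤ entropy μ :=
  le_ciInf (Hn_nonneg μ)

lemma negMulLog_bound (x a : ℝ) (hx : 0 ≤ x) (ha : 0 < a) :
    Real.negMulLog x ≤ x * Real.log a + 1 / a := by
  have h := Real.negMulLog_le_one_sub_self (mul_nonneg ha.le hx)
  rw [Real.negMulLog_mul] at h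
  have e : Real.negMulLog a = - a * Real.log a := rfl
  rw [e] at h
  have h2 : a * Real.negMulLog x ≤ a * (x * Real.log a + 1 / a) := by
    have : a * (x * Real.log a + 1 / a) = a * x * Real.log a + 1 := by field_simp
    rw [this]
    nlinarith [mul_nonneg ha.le hx]
  exact le_of_mul_le_mul_left h2 ha

lemma sum_negMulLog_bound {ι : Type*} (S : Finset ι) (q : ι → ℝ) (hq : ∀ i, 0 ≤ q i) (a : ℝ)
    (ha : 0 < a) (hS : (S.card : ℝ) ≤ a) :
    ∑ i ∈ S, Real.negMulLog (q i) ≤ (∑ i ∈ S, q i) * Real.log a + 1 := by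
  calc ∑ i ∈ S, Real.negMulLog (q i) ≤ ∑ i ∈ S, (q i * Real.log a + 1 / a) :=
        Finset.sum_le_sum fun i _ => negMulLog_bound _ _ (hq i) ha
    _ = (∑ i ∈ S, q i) * Real.log a + S.card * (1 / a) := by
        rw [Finset.sum_add_distrib, Finset.sum_mul]; simp
    _ ≤ _ := by
        have : (S.card : ℝ) * (1 / a) ≤ 1 := by
          rw [mul_one_div, div_le_one ha]; exact hS
        linarith

lemma Hn_bound (μ : ProbabilityMeasure ↥(SigmaD M N)) (n p : ℕ) (hp : 0 < p)
    (hD : 0 < Fintype.card (DMSym M N))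
    (S : Finset (Fin (n + 1) → DMSym M N)) (hS : S.card ≤ p) (ε : ℝ)
    (h : ∑ w ∈ Sᶜ, cyl μ n w ≤ ε) :
    Hn μ n ≤ (Real.log p + 2) / (n + 1) + ε * Real.log (Fintype.card (DMSym M N)) := by
  unfold Hn
  rw [div_le_iff₀ (by positivity), add_mul, div_mul_cancel₀ _ (by positivity)]
  rw [← Finset.sum_add_sum_compl S]
  have h1 := sum_negMulLog_bound S (cyl μ n) (cyl_nonneg μ n) p (by exact_mod_cast hp)
    (by exact_mod_cast hS)
  have h2 := sum_negMulLog_bound Sᶜ (cyl μ n) (cyl_nonneg μ n)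
    ((Fintype.card (DMSym M N) : ℝ) ^ (n + 1)) (by positivity) (by
      have := Finset.card_le_univ Sᶜ
      rw [Fintype.card_fun, Fintype.card_fin] at this
      exact_mod_cast this)
  rw [Real.log_pow] at h2
  have l1 : 0 ≤ Real.log p := Real.log_natCast_nonneg p
  have l2 : 0 ≤ Real.log (Fintype.card (DMSym M N)) := Real.log_natCast_nonneg _
  have h3 := mul_le_mul_of_nonneg_right (sum_cyl_le_one μ n S) l1
  have h4 := mul_le_mul_of_nonneg_right h
    (show 0 ≤ ((n + 1 : ℕ) : ℝ) * Real.log (Fintype.card (DMSym M N)) by positivity)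
  push_cast at h2 h4
  nlinarith

/-! ### Openness -/

lemma continuous_int (f : C(↥(SigmaD M N), ℝ)) : Continuous (intCf f) :=
  ProbabilityMeasure.continuous_integral_boundedContinuousFunction
    (BoundedContinuousFunction.mkOfCompact f)

lemma int_sub (f g : C(↥(SigmaD M N), ℝ)) (μ : ProbabilityMeasure ↥(SigmaD M N)) :
    intCf (f - g) μ = intCf f μ - intCf g μ :=
  integral_sub (integrable_cf f μ) (integrable_cf g μ)

lemma int_abs_le (f : C(↥(SigmaD M N), ℝ)) (μ : ProbabilityMeasure ↥(SigmaD M N)) :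
    |intCf f μ| ≤ ‖f‖ := by
  have := norm_integral_le_of_norm_le_const (μ := μ.toMeasure) (f := f) (C := ‖f‖)
    (Eventually.of_forall fun x => f.norm_coe_le_norm x)
  simpa [intCf] using this

lemma continuous_int_joint : Continuous fun z : C(↥(SigmaD M N), ℝ) ×
    ProbabilityMeasure ↥(SigmaD M N) => intCf z.1 z.2 := by
  rw [continuous_iff_continuousAt]
  rintro ⟨f, μ⟩
  rw [ContinuousAt, tendsto_iff_dist_tendsto_zero]
  have h1 : Tendsto (fun z : C(↥(SigmaD M N), ℝ) × ProbabilityMeasure ↥(SigmaD M N) =>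
      ‖z.1 - f‖ + |intCf f z.2 - intCf f μ|) (𝓝 (f, μ)) (𝓝 0) := by
    have hc : Continuous (fun z : C(↥(SigmaD M N), ℝ) × ProbabilityMeasure ↥(SigmaD M N) =>
      ‖z.1 - f‖ + |intCf f z.2 - intCf f μ|) := by
      have := (continuous_int f).comp (continuous_snd (X := C(↥(SigmaD M N), ℝ)))
      exact (continuous_fst.sub continuous_const).norm.add (this.sub continuous_const).abs
    have := hc.tendsto (f, μ)
    simpa using this
  refine squeeze_zero (fun _ => dist_nonneg) (fun z => ?_) h1
  rw [Real.dist_eq]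
  have h2 := int_abs_le (z.1 - f) z.2
  rw [int_sub] at h2
  calc |intCf z.1 z.2 - intCf f μ|
      = |(intCf z.1 z.2 - intCf f z.2) + (intCf f z.2 - intCf f μ)| := by congr 1; ring
    _ ≤ _ := (abs_add_le _ _).trans (by gcongr)

lemma isClosed_MinvD : IsClosed (MinvD M N) := by
  have : MinvD M N = {μ | μ.map (continuous_shiftD (M := M) (N := N)).measurable.aemeasurable
      = μ} := by
    ext μ
    constructor
    · intro h
      have h' : MeasurePreserving (shiftD M N) μ.toMeasure μ.toMeasure := h
      apply Subtype.ext
      exact h'.map_eq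
    · intro h
      refine ⟨continuous_shiftD.measurable, ?_⟩
      exact congrArg Subtype.val h
  rw [this]
  exact isClosed_eq (ProbabilityMeasure.continuous_map continuous_shiftD) continuous_id

lemma continuous_Hn (n : ℕ) :
    Continuous fun μ : ProbabilityMeasure ↥(SigmaD M N) => Hn μ n := by
  unfold Hn
  simp only [cyl_eq_int]
  refine Continuous.div_const (continuous_finsetSum _ fun w _ => ?_) _
  exact Real.continuous_negMulLog.comp (continuous_int _)

/-- Functions whose maximizing measures have entropy less than `δ`. -/
def GG (M N : ℕ) (δ : ℝ) : Set C(↥(SigmaD M N), ℝ) := {f | ∀ μ ∈ Mmax M N f, entropy μ < δ}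

lemma isOpen_GG (δ : ℝ) : IsOpen (GG M N δ) := by
  rw [← isClosed_compl_iff]
  let Z : Set (C(↥(SigmaD M N), ℝ) × ProbabilityMeasure ↥(SigmaD M N)) :=
    {z | z.2 ∈ MinvD M N} ∩ (⋂ ν ∈ MinvD M N, {z | intCf z.1 ν ≤ intCf z.1 z.2}) ∩
      ⋂ n, {z | δ ≤ Hn z.2 n}
  have hZ : IsClosed Z := by
    refine IsClosed.inter (IsClosed.inter ?_ ?_) ?_
    · exact isClosed_MinvD.preimage continuous_snd
    · refine isClosed_iInter fun ν => isClosed_iInter fun _ => ?_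
      refine isClosed_le ?_ continuous_int_joint
      exact continuous_int_joint.comp (continuous_fst.prodMk continuous_const)
    · exact isClosed_iInter fun n =>
        isClosed_le continuous_const ((continuous_Hn n).comp continuous_snd)
  have e : (GG M N δ)ᶜ = Prod.fst '' Z := by
    ext f
    constructor
    · intro hf
      have hf' : ∃ μ ∈ Mmax M N f, δ ≤ entropy μ := by
        by_contra! hcon
        exact hf hcon
      obtain ⟨μ, hμ, hδ⟩ := hf'
      refine ⟨(f, μ), ⟨⟨hμ.1, ?_⟩, ?_⟩, rfl⟩
      · exact Set.mem_iInter₂.2 fun ν hν => hμ.2 ν hν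
      · exact Set.mem_iInter.2 fun n => hδ.trans (ciInf_le (Hn_bdd μ) n)
    · rintro ⟨⟨g, μ⟩, ⟨⟨h1, h2⟩, h3⟩, rfl⟩ hf
      have h4 : μ ∈ Mmax M N g := ⟨h1, fun ν hν => Set.mem_iInter₂.1 h2 ν hν⟩
      have h5 : δ ≤ entropy μ := le_ciInf fun n => Set.mem_iInter.1 h3 n
      exact absurd (hf μ h4) (not_lt.2 h5)
  rw [e]
  exact isClosedMap_fst_of_compactSpace _ hZ

/-! ### Density -/

lemma constPt_mem (k : Fin M) : (fun _ => DMSym.la k : ℤ → DMSym M N) ∈ SigmaD M N := by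
  have h := perPt_mem (fun _ => DMSym.la k : ℤ → DMSym M N) 1 one_pos
    ⟨[k], Or.inr (by simp [W, red, dyckStep])⟩
  exact h

lemma dense_GG (hM : 2 ≤ M) (δ : ℝ) (hδ : 0 < δ) : Dense (GG M N δ) := by
  rw [Metric.dense_iff]
  intro f r hr
  have hD : 0 < Fintype.card (DMSym M N) :=
    Fintype.card_pos_iff.2 ⟨DMSym.la ⟨0, by omega⟩⟩
  set c := Real.log (Fintype.card (DMSym M N)) with hc
  have hc0 : 0 ≤ c := Real.log_natCast_nonneg _
  obtain ⟨ε, hε, hεr, hεc⟩ : ∃ ε : ℝ, 0 < ε ∧ ε < r ∧ ε * c < δ / 2 := by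
    refine ⟨min (r / 2) (δ / (4 * (c + 1))), by positivity, ?_, ?_⟩
    · exact (min_le_left _ _).trans_lt (by linarith)
    · calc _ ≤ δ / (4 * (c + 1)) * c := by gcongr; exact min_le_right _ _
        _ < δ / 2 := by
          rw [div_mul_eq_mul_div, div_lt_div_iff₀ (by positivity) (by positivity)]
          nlinarith
  -- choose a nearly optimal periodic orbit
  let A : Set ℝ := {t | ∃ (y : ↥(SigmaD M N)) (p : ℕ), 0 < p ∧ (shiftD M N)^[p] y = y ∧
    t = BS f p y / p}
  have hAne : A.Nonempty :=
    ⟨_, ⟨_, constPt_mem ⟨0, by omega⟩⟩, 1, one_pos, rfl, rfl⟩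
  have hAbdd : BddAbove A := by
    refine ⟨‖f‖, ?_⟩
    rintro _ ⟨y, p, hp, -, rfl⟩
    rw [div_le_iff₀ (by exact_mod_cast hp)]
    unfold BS
    calc _ ≤ ∑ i ∈ Finset.range p, ‖f‖ :=
          Finset.sum_le_sum fun i _ => (abs_le.1 (f_le_norm f _)).2
      _ = _ := by simp [mul_comm]
  obtain ⟨_, ⟨y, p, hp, hy, rfl⟩, hlt⟩ :=
    exists_lt_of_lt_csSup hAne (show sSup A - ε * ε < sSup A by nlinarith)
  have hupper : ∀ μ ∈ MinvD M N, intCf f μ ≤ sSup A := by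
    intro μ hμ
    refine int_le f (sSup A) ?_ μ hμ
    intro y p hp hy
    have := le_csSup hAbdd ⟨y, p, hp, hy, rfl⟩
    rw [div_le_iff₀ (by exact_mod_cast hp)] at this
    linarith
  -- choose the cylinder length
  obtain ⟨n, hn⟩ := exists_nat_gt ((Real.log p + 2) / (δ / 2))
  have hn' : (Real.log p + 2) / (n + 1) < δ / 2 := by
    rw [div_lt_iff₀ (by positivity)] at hn ⊢
    nlinarith
  let S : Finset (Fin (n + 1) → DMSym M N) :=
    (Finset.range p).image fun i => wrd n ((shiftD M N)^[i] y)
  have hS : S.card ≤ p := Finset.card_image_le.trans (by simp)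
  refine ⟨f - ε • wInd n Sᶜ, ?_, ?_⟩
  · rw [Metric.mem_ball, dist_eq_norm]
    have : f - ε • wInd n Sᶜ - f = -(ε • wInd n Sᶜ) := by abel
    rw [this, norm_neg]
    refine lt_of_le_of_lt ?_ hεr
    rw [ContinuousMap.norm_le _ hε.le]
    intro x
    simp only [ContinuousMap.smul_apply, wInd, ContinuousMap.coe_mk]
    split_ifs <;> simp [abs_of_pos hε, hε.le]
  · intro μ hμ
    obtain ⟨ν, hν, hνi⟩ := exists_per_meas y p hp hy
    have h1 := hμ.2 ν hν
    have hsm : ∀ μ' : ProbabilityMeasure ↥(SigmaD M N),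
        intCf (ε • wInd n Sᶜ) μ' = ε * intCf (wInd n Sᶜ) μ' := fun μ' =>
      integral_const_mul ε _
    rw [int_sub, int_sub, hsm, hsm] at h1
    have h2 : intCf (wInd n Sᶜ) ν = 0 := by
      rw [hνi]
      have : BS (wInd n Sᶜ) p y = 0 := by
        unfold BS
        apply Finset.sum_eq_zero
        intro i hi
        have : wrd n ((shiftD M N)^[i] y) ∈ S := Finset.mem_image_of_mem _ hi
        simp [wInd, this]
      rw [this, zero_div]
    have h3 := hupper μ hμ.1
    rw [h2, hνi f] at h1
    have h4 : ε * intCf (wInd n Sᶜ) μ ≤ ε * ε := by linarith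
    have h5 : intCf (wInd n Sᶜ) μ ≤ ε := le_of_mul_le_mul_left h4 hε
    rw [← sum_cyl] at h5
    calc entropy μ ≤ Hn μ n := ciInf_le (Hn_bdd μ) n
      _ ≤ _ := Hn_bound μ n p hp hD S hS ε h5
      _ < δ := by linarith

lemma target_eq : {f : C(↥(SigmaD M N), ℝ) | ∀ μ ∈ Mmax M N f, entropy μ = 0} =
    ⋂ k : ℕ, GG M N (1 / ((k : ℝ) + 1)) := by
  ext f
  rw [Set.mem_iInter]
  constructor
  · intro h k μ hμ
    rw [h μ hμ]; positivity
  · intro h μ hμ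
    refine le_antisymm ?_ (entropy_nonneg μ)
    by_contra! hpos
    obtain ⟨k, hk⟩ := exists_nat_one_div_lt hpos
    exact absurd (h k μ hμ) (not_lt.2 hk.le)

end Ent

/-- Theorem A(a): the set of continuous functions all of whose maximizing measures have
zero entropy is a dense `G_δ` subset of `C(Σ_D)`. -/
theorem zero_entropy_maximizing_generic (M N : ℕ) (hM : 2 ≤ M) :
    Dense {f : C(↥(SigmaD M N), ℝ) | ∀ μ ∈ Mmax M N f, entropy μ = 0} ∧
    IsGδ {f : C(↥(SigmaD M N), ℝ) | ∀ μ ∈ Mmax M N f, entropy μ = 0} := by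
  rw [target_eq]
  exact ⟨dense_iInter_of_isOpen (fun k => isOpen_GG _)
      (fun k => dense_GG hM _ (by positivity)),
    IsGδ.iInter_of_isOpen fun k => isOpen_GG _⟩
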